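/- Let M be a (4k-4)×(4k-4) Seifert-type matrix over ℤ (as described in the context, built from blocks A and B). Then the associated Alexander–Conway determinant factors as det(t^{-1/2} M − t^{1/2} M^T) = ((−1)^{k−1} − z^{2k−2})((−1)^{k+1} − z^{2k−2}) = 1 + (−1)^k·2·z^{2k−2} + z^{4k−4}, where z = t^{−1/2} − t^{1/2}. -/

import Mathlib

open LaurentPolynomial

/-- The Seifert matrix `M(K_k)` of size `4k-4`: top-left `(2k-2)×(2k-2)` zero block,
top-middle block `A`, last column `(1,0,…,0,-1)ᵀ` in the top rows, middle-left block `B`,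
middle-middle block with a single `1` in position `(1,1)`, and bottom row
`(0,…,0,-1 | 0,…,0 | 0)`.  (Indices in the description are 1-based; here 0-based.) -/
def seifertM (k : ℕ) : Matrix (Fin (4 * k - 4)) (Fin (4 * k - 4)) ℤ :=
  Matrix.of fun i j =>
    if i.val < 2 * k - 2 then
      if j.val < 2 * k - 2 then 0
      else if j.val < (2 * k - 2) + (2 * k - 3) then
        -- block A, with 0-based row index i.val and column index j.val - (2k-2)
        (if i.val = j.val - (2 * k - 2) then 1
         else if 2 ≤ i.val ∧ i.val % 2 = 0 ∧ j.val - (2 * k - 2) = i.val - 1 then -1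
         else 0)
      else
        -- last column: (1,0,…,0,-1)ᵀ
        (if i.val = 0 then 1 else if i.val = 2 * k - 3 then -1 else 0)
    else if i.val < (2 * k - 2) + (2 * k - 3) then
      if j.val < 2 * k - 2 then
        -- block B, with 0-based row index i.val - (2k-2)
        (if i.val - (2 * k - 2) = j.val then 1
         else if (i.val - (2 * k - 2)) % 2 = 0 ∧ j.val = (i.val - (2 * k - 2)) + 1 then -1
         else 0)
      else if j.val < (2 * k - 2) + (2 * k - 3) then
        (if i.val = 2 * k - 2 ∧ j.val = 2 * k - 2 then 1 else 0)
      else 0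
    else
      -- bottom row
      (if j.val = 2 * k - 3 then -1 else 0)

/-- The upper right block (with parameters `x = t^{-1/2}`, `y = t^{1/2}`). -/
def auxP {R : Type*} [CommRing R] (m : ℕ) (x y : R) :
    Matrix (Fin (2 * m + 1 + 1)) (Fin (2 * m + 1 + 1)) R :=
  Matrix.of fun i j =>
    if j.val = 2 * m + 1 then
      (if i.val = 0 then x else if i.val = 2 * m + 1 then -(x - y) else 0)
    else if i.val = j.val then x - y
    else if i.val = j.val + 1 then (if i.val % 2 = 0 then -x else y)
    else 0

theorem aux_prod {R : Type*} [CommRing R] (m : ℕ) (x y : R) :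
    ∏ i ∈ Finset.range (2 * m + 1), (if (i + 1) % 2 = 0 then -x else y)
      = y * (-(x * y)) ^ m := by
  induction m with
  | zero => simp
  | succ m ih =>
    rw [show 2 * (m + 1) + 1 = (2 * m + 1) + 1 + 1 by ring, Finset.prod_range_succ,
      Finset.prod_range_succ, ih, if_pos (by omega), if_neg (by omega)]
    ring

theorem auxP_det {R : Type*} [CommRing R] (m : ℕ) (x y : R) :
    (auxP m x y).det = -(x - y) ^ (2 * m + 2) + (-(x * y)) ^ (m + 1) := by
  rw [Matrix.det_succ_row_zero, Fin.sum_univ_succ, Fin.sum_univ_castSucc]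
  rw [Finset.sum_eq_zero]
  · have h1 : ((auxP m x y).submatrix Fin.succ (Fin.succAbove 0)).det
        = -(x - y) ^ (2 * m + 1) := by
      rw [Matrix.det_of_isLowerTriangular]
      · rw [Fin.prod_univ_castSucc]
        have : ∀ i : Fin (2 * m), (auxP m x y).submatrix Fin.succ (Fin.succAbove 0)
            i.castSucc i.castSucc = x - y := by
          intro i
          have := i.2
          simp [auxP]
          omega
        simp only [this]
        simp [auxP]
        ring
      · intro i j hij
        have hij' : i.val < j.val := by simpa using hij
        have := j.2
        simp only [auxP, Matrix.submatrix_apply, Matrix.of_apply, Fin.succAbove_zero, Fin.val_succ]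
        split_ifs <;> first | omega | rfl | simp_all
    have h2 : ((auxP m x y).submatrix Fin.succ (Fin.succAbove (Fin.last (2 * m)).succ)).det
        = y * (-(x * y)) ^ m := by
      rw [Fin.succ_last, Fin.succAbove_last, Matrix.det_of_isUpperTriangular]
      · rw [← aux_prod, ← Fin.prod_univ_eq_prod_range (fun i => if (i + 1) % 2 = 0 then -x else y)]
        apply Finset.prod_congr rfl
        intro i _
        have := i.2
        simp only [auxP, Matrix.submatrix_apply, Matrix.of_apply, Fin.val_succ, Fin.val_castSucc]
        rw [if_neg (by omega), if_neg (by omega), if_pos (by trivial)]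
      · intro i j hij
        have hij' : j.val < i.val := by simpa using hij
        have := i.2
        simp only [auxP, Matrix.submatrix_apply, Matrix.of_apply, Fin.val_succ, Fin.val_castSucc]
        split_ifs <;> first | omega | rfl | simp_all
    rw [h1, h2]
    have e1 : auxP m x y 0 0 = x - y := by simp [auxP]
    have e2 : auxP m x y 0 (Fin.last (2 * m)).succ = x := by simp [auxP]
    rw [e1, e2]
    have e3 : (-1 : R) ^ ((Fin.last (2 * m)).succ : Fin (2 * m + 1 + 1)).val = -1 := by
      simp [pow_succ]
    rw [e3]
    simp only [Fin.val_zero, pow_zero]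
    ring
  · intro i _
    have := i.2
    have e : auxP m x y 0 i.castSucc.succ = 0 := by
      simp [auxP]
      omega
    rw [e]; ring

theorem aux_blocks {R : Type*} [CommRing R] {n : ℕ} (hn : Even n)
    (P Q D : Matrix (Fin n) (Fin n) R) :
    (Matrix.fromBlocks 0 P Q D).det = P.det * Q.det := by
  have hU : (Matrix.fromBlocks 1 (-1) 0 1 : Matrix (Fin n ⊕ Fin n) (Fin n ⊕ Fin n) R).det = 1 := by
    simp [Matrix.det_fromBlocks_zero₂₁]
  have hL : (Matrix.fromBlocks 1 0 1 1 : Matrix (Fin n ⊕ Fin n) (Fin n ⊕ Fin n) R).det = 1 := by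
    simp [Matrix.det_fromBlocks_zero₁₂]
  have key : Matrix.fromBlocks 0 P Q D * (Matrix.fromBlocks 1 (-1) 0 1 *
      Matrix.fromBlocks 1 0 1 1 * Matrix.fromBlocks 1 (-1) 0 1) =
      Matrix.fromBlocks P 0 D (-Q) := by
    simp [Matrix.fromBlocks_multiply]
  have := congrArg Matrix.det key
  rw [Matrix.det_mul, Matrix.det_mul, Matrix.det_mul, hU, hL, Matrix.det_fromBlocks_zero₁₂,
    Matrix.det_neg, Fintype.card_fin, hn.neg_one_pow] at this
  simpa using this

theorem seifert_top (m : ℕ) (e : Fin (2 * m + 1 + 1) ⊕ Fin (2 * m + 1 + 1) ≃ Fin (4 * (m + 2) - 4))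
    (hl : ∀ i, (e (Sum.inl i)).val = i.val) (hr : ∀ i, (e (Sum.inr i)).val = 2 * m + 2 + i.val)
    {R : Type*} [CommRing R] (f : ℤ →+* R) (x y : R) (i j : Fin (2 * m + 1 + 1)) :
    x * f (seifertM (m + 2) (e (Sum.inl i)) (e (Sum.inr j)))
      - y * f (seifertM (m + 2) (e (Sum.inr j)) (e (Sum.inl i))) = auxP m x y i j := by
  have hi := i.2
  have hj := j.2
  simp only [seifertM, auxP, Matrix.of_apply, hl, hr]
  generalize i.val = a at *
  generalize j.val = b at *
  have q : 2 * (m + 2) - 2 = 2 * m + 2 := by omega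
  have q3 : 2 * (m + 2) - 3 = 2 * m + 1 := by omega
  have q2 : 2 * m + 2 + b - (2 * m + 2) = b := by omega
  simp only [q, q2, q3]
  have r1 : a < 2 * m + 2 := hi
  have r2 : ¬ (2 * m + 2 + b < 2 * m + 2) := by omega
  simp only [r1, r2, if_true, if_false]
  by_cases hb : b = 2 * m + 1
  · subst hb
    simp only [lt_irrefl, if_false, if_true, add_lt_add_iff_left]
    split_ifs <;> first | omega | (simp; try ring)
  · have hb' : b < 2 * m + 1 := by omega
    simp only [add_lt_add_iff_left, hb, hb', if_false, if_true]
    split_ifs <;> first | omega | (simp; try ring)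

theorem seifertM_det (k : ℕ) (hk : 2 ≤ k) :
    (Matrix.det
        (Matrix.of fun i j : Fin (4 * k - 4) =>
          T (-1) * C (seifertM k i j) - T 1 * C (seifertM k j i)) =
      ((-1) ^ (k - 1) - (T (-1) - T 1 : LaurentPolynomial ℤ) ^ (2 * k - 2)) *
        ((-1) ^ (k + 1) - (T (-1) - T 1) ^ (2 * k - 2))) ∧
    ((-1 : LaurentPolynomial ℤ) ^ (k - 1) - (T (-1) - T 1) ^ (2 * k - 2)) *
        ((-1) ^ (k + 1) - (T (-1) - T 1) ^ (2 * k - 2)) =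
      1 + (-1) ^ k * 2 * (T (-1) - T 1) ^ (2 * k - 2) + (T (-1) - T 1) ^ (4 * k - 4) := by
  obtain ⟨m, rfl⟩ : ∃ m, k = m + 2 := ⟨k - 2, by omega⟩
  have q1 : m + 2 - 1 = m + 1 := by omega
  have q2 : 2 * (m + 2) - 2 = 2 * m + 2 := by omega
  have q4 : 4 * (m + 2) - 4 = 2 * (2 * m + 2) := by omega
  constructor
  · let e : Fin (2 * m + 1 + 1) ⊕ Fin (2 * m + 1 + 1) ≃ Fin (4 * (m + 2) - 4) :=
      finSumFinEquiv.trans (finCongr (by omega))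
    have hl : ∀ i, (e (Sum.inl i)).val = i.val := by intro i; simp [e]
    have hr : ∀ i, (e (Sum.inr i)).val = 2 * m + 2 + i.val := by
      intro i
      simp [e]
      omega
    rw [← Matrix.det_submatrix_equiv_self e, ← Matrix.fromBlocks_toBlocks (Matrix.submatrix _ e e)]
    set N := (Matrix.of fun i j : Fin (4 * (m + 2) - 4) =>
          (T (-1) * C (seifertM (m + 2) i j) - T 1 * C (seifertM (m + 2) j i) :
            LaurentPolynomial ℤ)).submatrix e e with hN
    have h11 : N.toBlocks₁₁ = 0 := by
      ext1 i j
      have hi := i.2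
      have hj := j.2
      have z : ∀ a b : Fin (2 * m + 1 + 1),
          seifertM (m + 2) (e (Sum.inl a)) (e (Sum.inl b)) = 0 := by
        intro a b
        have ha := a.2
        have hb := b.2
        simp only [seifertM, Matrix.of_apply, hl]
        rw [if_pos (by omega), if_pos (by omega)]
      simp [hN, Matrix.toBlocks₁₁, z]
    have h12 : N.toBlocks₁₂ = auxP m (T (-1)) (T 1) := by
      ext1 i j
      rw [← seifert_top m e hl hr C]
      rfl
    have h21 : N.toBlocks₂₁ = -(auxP m (T 1) (T (-1))).transpose := by
      ext1 i j
      rw [Matrix.neg_apply, Matrix.transpose_apply, ← seifert_top m e hl hr C, neg_sub]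
      rfl
    have hTT : (T (-1) * T 1 : LaurentPolynomial ℤ) = 1 := by
      rw [← T_add]; simp
    have hev : Even (2 * m + 1 + 1) := ⟨m + 1, by ring⟩
    rw [h11, h12, h21, aux_blocks hev, Matrix.det_neg, Matrix.det_transpose, Fintype.card_fin,
      hev.neg_one_pow, auxP_det, auxP_det, mul_comm (T 1) (T (-1)), hTT, q1, q2,
      ← neg_sub (T (-1) : LaurentPolynomial ℤ) (T 1), Even.neg_pow hev]
    ring
  · rw [q1, q2, q4]
    have h : ((-1 : LaurentPolynomial ℤ) ^ m) * (-1) ^ m = 1 := by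
      rw [← mul_pow]; simp
    generalize (T (-1) - T 1 : LaurentPolynomial ℤ) = z
    rw [mul_comm 2 (2 * m + 2), pow_mul z]
    generalize z ^ (2 * m + 2) = w
    simp only [pow_add]
    linear_combination h
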